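/- Let K ⊆ V ⊗ k be a strictly characteristic subspace with normalized generator e of l_K and structure constants a_i = ⟨e, φ^{σ₀+i}(e)⟩ (1 ≤ i ≤ σ₀ − 1), and let m be the largest positive divisor of σ₀ such that σ₀/m is odd and a_i = 0 for every 1 ≤ i ≤ σ₀ − 1 not divisible by 2m, with m = 0 if no such divisor exists. Then O_K(V) is a cyclic group of order p^m + 1. -/

import Mathlib

open TensorProduct

noncomputable section

variable (p : ℕ) [Fact p.Prime] (k : Type) [Field k] [CharP k p] [Algebra (ZMod p) k]

/-- The `p`-power (Frobenius) map on `k` as a `ZMod p`-linear map. -/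
def frobLin : k →ₗ[ZMod p] k where
  toFun a := a ^ p
  map_add' a b := add_pow_char a b p
  map_smul' c a := by
    simp only [RingHom.id_apply]
    rw [Algebra.smul_def, Algebra.smul_def, mul_pow, ← map_pow, ZMod.pow_card]

variable (V : Type) [AddCommGroup V] [Module (ZMod p) V]

/-- The Frobenius-semilinear endomorphism `φ = id_V ⊗ (λ ↦ λ^p)` of `k ⊗[𝔽_p] V`. -/
def frobT : (k ⊗[ZMod p] V) →ₛₗ[frobenius k p] (k ⊗[ZMod p] V) where
  toFun := LinearMap.rTensor V (frobLin p k)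
  map_add' := map_add _
  map_smul' c x := by
    induction x using TensorProduct.induction_on with
    | zero => simp
    | tmul a v =>
        simp [smul_tmul', frobLin, frobenius_def, mul_pow]
    | add x y hx hy => simp_all [smul_add]

variable [IsAlgClosed k]

instance : RingHomSurjective (frobenius k p) := ⟨surjective_frobenius k p⟩

/-- The base change to `k` of the bilinear form `B`. -/
abbrev bcForm (B : LinearMap.BilinForm (ZMod p) V) :
    LinearMap.BilinForm k (k ⊗[ZMod p] V) :=
  LinearMap.BilinForm.baseChange k B

variable (σ₀ : ℕ) (B : LinearMap.BilinForm (ZMod p) V)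

/-- `K ⊆ V ⊗ k` is a characteristic subspace: totally isotropic of dimension `σ₀`,
and `K + φ(K)` has dimension `σ₀ + 1`. -/
def IsCharacteristicSub (K : Submodule k (k ⊗[ZMod p] V)) : Prop :=
  (∀ x ∈ K, ∀ y ∈ K, bcForm p k V B x y = 0) ∧
  Module.finrank k K = σ₀ ∧
  Module.finrank k ↥(K ⊔ Submodule.map (frobT p k V) K) = σ₀ + 1

/-- `K` is strictly characteristic if moreover `∑ᵢ φ^i(K) = V ⊗ k`. -/
def IsStrictlyCharacteristicSub (K : Submodule k (k ⊗[ZMod p] V)) : Prop :=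
  IsCharacteristicSub p k V σ₀ B K ∧
  (⨆ i : ℕ, (Submodule.map (frobT p k V))^[i] K) = ⊤

/-- `l_K = K ∩ φ(K) ∩ ⋯ ∩ φ^{σ₀ − 1}(K)`. -/
def lK (K : Submodule k (k ⊗[ZMod p] V)) : Submodule k (k ⊗[ZMod p] V) :=
  ⨅ i : Fin σ₀, (Submodule.map (frobT p k V))^[(i : ℕ)] K

/-- The group `O_K(V)` of isometries of `(V, B)` such that `g ⊗ k` maps `K` to itself. -/
def OK (K : Submodule k (k ⊗[ZMod p] V)) : Subgroup (V ≃ₗ[ZMod p] V) where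
  carrier := {g : V ≃ₗ[ZMod p] V | (∀ x y : V, B (g x) (g y) = B x y) ∧
    Submodule.map (LinearMap.baseChange k (g : V →ₗ[ZMod p] V)) K = K}
  one_mem' := by
    refine ⟨fun x y => rfl, ?_⟩
    rw [LinearEquiv.coe_toLinearMap_one, LinearMap.baseChange_id, Submodule.map_id]
  mul_mem' := by
    rintro g h ⟨hg1, hg2⟩ ⟨hh1, hh2⟩
    refine ⟨fun x y => (hg1 (h x) (h y)).trans (hh1 x y), ?_⟩
    have hco : ((g * h : V ≃ₗ[ZMod p] V) : V →ₗ[ZMod p] V)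
        = (g : V →ₗ[ZMod p] V).comp (h : V →ₗ[ZMod p] V) := rfl
    rw [hco, LinearMap.baseChange_comp, Submodule.map_comp, hh2, hg2]
  inv_mem' := by
    rintro g ⟨hg1, hg2⟩
    constructor
    · intro x y
      have h1 : g (g⁻¹ x) = x := g.apply_symm_apply x
      have h2 : g (g⁻¹ y) = y := g.apply_symm_apply y
      have := hg1 (g⁻¹ x) (g⁻¹ y)
      rw [h1, h2] at this
      exact this.symm
    · conv_lhs => rw [← hg2]
      rw [← Submodule.map_comp, ← LinearMap.baseChange_comp]
      have hco : ((g⁻¹ : V ≃ₗ[ZMod p] V) : V →ₗ[ZMod p] V).comp (g : V →ₗ[ZMod p] V)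
          = LinearMap.id := by
        ext x
        exact g.symm_apply_apply x
      rw [hco, LinearMap.baseChange_id, Submodule.map_id]

end


theorem aux_pow_dvd_odd (p a c : ℕ) (hc : Odd c) : p ^ a + 1 ∣ p ^ (a * c) + 1 := by
  rw [pow_mul]
  simpa using hc.nat_add_dvd_pow_add_pow (p ^ a) 1

theorem aux_iter_pow {k : Type} [Monoid k] (p n : ℕ) (l : k) :
    (fun x : k => x ^ p)^[n] l = l ^ p ^ n := by
  induction n with
  | zero => simp
  | succ n ih => rw [Function.iterate_succ_apply', ih, ← pow_mul, pow_succ]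

/-- The numerical heart: the eigenvalue conditions amount to `l ^ (p ^ m + 1) = 1`. -/
theorem aux_numeric (p : ℕ) (hodd : Odd p) (k : Type) [Field k]
    (s : ℕ) (hs : 1 ≤ s) (a : ℕ → k) (h0 : ∀ n < s, a n = 0) (h1 : a s = 1) (m : ℕ)
    (hm : m = sSup {m' : ℕ | 0 < m' ∧ m' ∣ s ∧ Odd (s / m') ∧
      ∀ i : ℕ, 1 ≤ i → i ≤ s - 1 → ¬ (2 * m' ∣ i) → a (s + i) = 0}) (l : k) :
    (∀ n < 2 * s, a n = 0 ∨ l ^ (p ^ n + 1) = 1) ↔ l ^ (p ^ m + 1) = 1 := by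
  set M := {m' : ℕ | 0 < m' ∧ m' ∣ s ∧ Odd (s / m') ∧
      ∀ i : ℕ, 1 ≤ i → i ≤ s - 1 → ¬ (2 * m' ∣ i) → a (s + i) = 0} with hM
  have hbdd : BddAbove M := ⟨s, fun x hx => Nat.le_of_dvd (by omega) hx.2.1⟩
  have hsq : ∀ n, l ^ 2 = 1 → l ^ (p ^ n + 1) = 1 := by
    intro n hl
    obtain ⟨c, hc⟩ := (hodd.pow (n := n)).add_one
    rw [hc, ← two_mul, pow_mul, hl, one_pow]
  constructor
  · intro h
    by_cases hl2 : l ^ 2 = 1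
    · exact hsq m hl2
    have hls : l ^ (p ^ s + 1) = 1 := (h s (by omega)).resolve_left (by rw [h1]; exact one_ne_zero)
    have hl0 : l ≠ 0 := by rintro rfl; simp at hls
    have hFs : l ^ p ^ s = l⁻¹ := eq_inv_of_mul_eq_one_left (by rw [← pow_succ]; exact hls)
    set F : k → k := fun x => x ^ p with hF
    set c := Function.minimalPeriod F l with hc
    have hperiod : ∀ n, c ∣ n ↔ l ^ p ^ n = l := by
      intro n
      rw [← aux_iter_pow, hc, ← Function.isPeriodicPt_iff_minimalPeriod_dvd]; rfl
    have hcs : ¬ c ∣ s := by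
      rw [hperiod, hFs]
      intro h'
      apply hl2
      rw [pow_two]; nth_rewrite 1 [← h']; exact inv_mul_cancel₀ hl0
    have hc2s : c ∣ 2 * s := by
      rw [hperiod, two_mul, pow_add, pow_mul, hFs, inv_pow, hFs, inv_inv]
    have hcpos : 0 < c := Nat.pos_of_dvd_of_pos hc2s (by omega)
    -- c is even
    have hce : 2 ∣ c := by
      by_contra hne
      have : Nat.Coprime c 2 := by
        rw [Nat.coprime_comm]; exact (Nat.Prime.coprime_iff_not_dvd Nat.prime_two).2 hne
      exact hcs (this.dvd_of_dvd_mul_left hc2s)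
    obtain ⟨n, hn⟩ := hce
    have hns : n ∣ s := by
      rw [hn] at hc2s; exact Nat.dvd_of_mul_dvd_mul_left (by norm_num) hc2s
    have hnpos : 0 < n := by omega
    obtain ⟨t, ht⟩ := hns
    have htodd : Odd t := by
      rw [← Nat.not_even_iff_odd]
      rintro ⟨u, hu⟩
      exact hcs ⟨u, by rw [hn, ht, hu]; ring⟩
    have hnM : n ∈ M := by
      refine ⟨hnpos, ⟨t, ht⟩, ?_, ?_⟩
      · rw [ht, Nat.mul_div_cancel_left _ hnpos]; exact htodd
      · intro i hi1 hi2 hi3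
        refine (h (s + i) (by omega)).resolve_right ?_
        intro h'
        apply hi3
        rw [← hn, hperiod]
        have : l ^ p ^ (s + i) = l⁻¹ := eq_inv_of_mul_eq_one_left (by rw [← pow_succ]; exact h')
        rw [pow_add, pow_mul, hFs, inv_pow] at this
        exact inv_injective this
    have hFn : l ^ (p ^ n + 1) = 1 := by
      obtain ⟨u, hu⟩ := htodd
      have h2 : l ^ p ^ (c * u) = l := (hperiod _).1 (dvd_mul_right _ _)
      have : s = c * u + n := by rw [ht, hn, hu]; ring
      rw [this, pow_add, pow_mul, h2] at hFs
      rw [pow_succ, hFs]; exact inv_mul_cancel₀ hl0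
    have hmM : m ∈ M := hm ▸ Nat.sSup_mem ⟨n, hnM⟩ hbdd
    -- lcm
    have hlcm : Nat.lcm m n ∈ M := by
      refine ⟨Nat.lcm_pos hmM.1 hnpos, Nat.lcm_dvd hmM.2.1 ⟨t, ht⟩, ?_, ?_⟩
      · refine Odd.of_dvd_nat hmM.2.2.1 ?_
        exact Nat.div_dvd_div_left (Nat.lcm_dvd hmM.2.1 ⟨t, ht⟩) (Nat.dvd_lcm_left m n)
      · intro i hi1 hi2 hi3
        by_cases hA : 2 * m ∣ i
        · by_cases hB : 2 * n ∣ i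
          · exact absurd (by rw [← Nat.lcm_mul_left]; exact Nat.lcm_dvd hA hB) hi3
          · exact hnM.2.2.2 i hi1 hi2 hB
        · exact hmM.2.2.2 i hi1 hi2 hA
    have hle : Nat.lcm m n ≤ m := by
      conv_rhs => rw [hm]
      exact le_csSup hbdd hlcm
    have heq : Nat.lcm m n = m := le_antisymm hle (Nat.le_of_dvd (Nat.lcm_pos hmM.1 hnpos) (Nat.dvd_lcm_left m n))
    have hnm : n ∣ m := heq ▸ Nat.dvd_lcm_right m n
    obtain ⟨v, hv⟩ := hnm
    have hvodd : Odd v := by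
      obtain ⟨w, hw⟩ := hmM.2.1
      refine Odd.of_dvd_nat htodd ⟨w, ?_⟩
      apply Nat.eq_of_mul_eq_mul_left hnpos
      rw [← ht, hw, hv]; ring
    obtain ⟨z, hz⟩ := aux_pow_dvd_odd p n v hvodd
    rw [hv, hz, pow_mul, hFn, one_pow]
  · intro h n hn
    by_cases hne : M.Nonempty
    · have hmM : m ∈ M := hm ▸ Nat.sSup_mem hne hbdd
      have hdiv : ∀ d, p ^ m + 1 ∣ d → l ^ d = 1 := by
        rintro _ ⟨z, rfl⟩; rw [pow_mul, h, one_pow]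
      obtain ⟨t, ht⟩ := hmM.2.1
      have htodd : Odd t := by
        have := hmM.2.2.1
        rwa [ht, Nat.mul_div_cancel_left _ hmM.1] at this
      rcases lt_trichotomy n s with hlt | rfl | hgt
      · exact Or.inl (h0 n hlt)
      · right
        apply hdiv
        rw [ht]
        exact aux_pow_dvd_odd p m t htodd
      · by_cases hA : 2 * m ∣ n - s
        · right
          apply hdiv
          obtain ⟨u, hu⟩ := hA
          have : n = m * (t + 2 * u) := by
            rw [mul_add, ← ht]; have : m * (2 * u) = 2 * m * u := by ring
            omega
          rw [this]
          exact aux_pow_dvd_odd p m _ (htodd.add_even (even_two_mul u))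
        · left
          have := hmM.2.2.2 (n - s) (by omega) (by omega) hA
          rwa [Nat.add_sub_cancel' hgt.le] at this
    · have hm0 : m = 0 := by
        rw [hm, Set.not_nonempty_iff_eq_empty.1 hne]; exact csSup_empty
      right
      apply hsq
      simpa [hm0] using h

section Helpers

set_option linter.unusedSectionVars false

variable {p : ℕ} [Fact p.Prime] {k : Type} [Field k] [CharP k p] [Algebra (ZMod p) k]
variable {V : Type} [AddCommGroup V] [Module (ZMod p) V]

theorem frobT_tmul (a : k) (v : V) : frobT p k V (a ⊗ₜ[ZMod p] v) = (a ^ p) ⊗ₜ[ZMod p] v := rfl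

theorem frobT_smul (c : k) (x : k ⊗[ZMod p] V) :
    frobT p k V (c • x) = c ^ p • frobT p k V x := by
  rw [LinearMap.map_smulₛₗ, frobenius_def]

theorem frobT_iter_smul (n : ℕ) (c : k) (x : k ⊗[ZMod p] V) :
    (frobT p k V)^[n] (c • x) = c ^ p ^ n • (frobT p k V)^[n] x := by
  induction n with
  | zero => simp
  | succ n ih =>
    rw [Function.iterate_succ_apply', ih, frobT_smul, Function.iterate_succ_apply', ← pow_mul,
      pow_succ]

theorem frobT_injective : Function.Injective (frobT p k V) := by
  have h : Function.Injective (frobLin p k) := fun a b hab => by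
    exact frobenius_inj k p hab
  exact Module.Flat.rTensor_preserves_injective_linearMap (M := V) (frobLin p k) h

theorem bcForm_frobT (B : LinearMap.BilinForm (ZMod p) V) (x y : k ⊗[ZMod p] V) :
    LinearMap.BilinForm.baseChange k B (frobT p k V x) (frobT p k V y)
      = (LinearMap.BilinForm.baseChange k B x y) ^ p := by
  induction x using TensorProduct.induction_on with
  | zero => simp [(Fact.out : p.Prime).ne_zero]
  | add x x' hx hx' => simp only [map_add, LinearMap.add_apply, hx, hx', add_pow_char]
  | tmul a v =>
    induction y using TensorProduct.induction_on with
    | zero => simp [(Fact.out : p.Prime).ne_zero]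
    | add x x' hx hx' => simp only [map_add, hx, hx', add_pow_char]
    | tmul b w =>
      rw [frobT_tmul, frobT_tmul, LinearMap.BilinForm.baseChange_tmul,
        LinearMap.BilinForm.baseChange_tmul, Algebra.smul_def, Algebra.smul_def, mul_pow, mul_pow,
        ← map_pow, ZMod.pow_card]

theorem bcForm_frobT_iter (B : LinearMap.BilinForm (ZMod p) V) (n : ℕ) (x y : k ⊗[ZMod p] V) :
    LinearMap.BilinForm.baseChange k B ((frobT p k V)^[n] x) ((frobT p k V)^[n] y)
      = (LinearMap.BilinForm.baseChange k B x y) ^ p ^ n := by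
  induction n with
  | zero => simp
  | succ n ih =>
    rw [Function.iterate_succ_apply', Function.iterate_succ_apply', bcForm_frobT, ih, ← pow_mul,
      pow_succ]

theorem bcForm_baseChange (B : LinearMap.BilinForm (ZMod p) V) (g : V →ₗ[ZMod p] V)
    (hg : ∀ x y, B (g x) (g y) = B x y) (x y : k ⊗[ZMod p] V) :
    LinearMap.BilinForm.baseChange k B (g.baseChange k x) (g.baseChange k y)
      = LinearMap.BilinForm.baseChange k B x y := by
  induction x using TensorProduct.induction_on with
  | zero => simp
  | add x x' hx hx' => simp only [map_add, LinearMap.add_apply, hx, hx']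
  | tmul a v =>
    induction y using TensorProduct.induction_on with
    | zero => simp
    | add x x' hx hx' => simp only [map_add, hx, hx']
    | tmul b w =>
      rw [LinearMap.baseChange_tmul, LinearMap.baseChange_tmul,
        LinearMap.BilinForm.baseChange_tmul, LinearMap.BilinForm.baseChange_tmul, hg]

theorem baseChange_frobT (g : V →ₗ[ZMod p] V) (x : k ⊗[ZMod p] V) :
    g.baseChange k (frobT p k V x) = frobT p k V (g.baseChange k x) := by
  induction x using TensorProduct.induction_on with
  | zero => simp
  | add x x' hx hx' => simp only [map_add, hx, hx']
  | tmul a v => rw [frobT_tmul, LinearMap.baseChange_tmul, LinearMap.baseChange_tmul, frobT_tmul]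

theorem comm_iter (G : (k ⊗[ZMod p] V) →ₗ[k] (k ⊗[ZMod p] V))
    (hG : ∀ x, G (frobT p k V x) = frobT p k V (G x)) (n : ℕ) (x : k ⊗[ZMod p] V) :
    G ((frobT p k V)^[n] x) = (frobT p k V)^[n] (G x) := by
  induction n with
  | zero => rfl
  | succ n ih => rw [Function.iterate_succ_apply', Function.iterate_succ_apply', hG, ih]

theorem indep_of_frobT {ι : Type} [Fintype ι] (x : ι → k ⊗[ZMod p] V)
    (h : LinearIndependent k (fun i => frobT p k V (x i))) : LinearIndependent k x := by
  rw [Fintype.linearIndependent_iff] at h ⊢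
  intro c hc i
  have := h (fun i => c i ^ p) (by
    have h2 := congrArg (frobT p k V) hc
    rw [map_sum, map_zero] at h2
    simpa only [frobT_smul] using h2) i
  exact eq_zero_of_pow_eq_zero this

theorem indep_of_frobT_iter {ι : Type} [Fintype ι] (n : ℕ) (x : ι → k ⊗[ZMod p] V)
    (h : LinearIndependent k (fun i => (frobT p k V)^[n] (x i))) : LinearIndependent k x := by
  induction n with
  | zero => exact h
  | succ n ih =>
    apply ih
    apply indep_of_frobT
    simpa only [Function.iterate_succ_apply'] using h

theorem one_tmul_injective : Function.Injective (fun v : V => (1 : k) ⊗ₜ[ZMod p] v) := by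
  exact Module.FaithfullyFlat.tensorProduct_mk_injective (A := ZMod p) (B := k) V

theorem frobT_fixed [Module.Finite (ZMod p) V] (x : k ⊗[ZMod p] V) (hx : frobT p k V x = x) :
    ∃ v : V, x = (1 : k) ⊗ₜ[ZMod p] v := by
  classical
  let bV := Module.finBasis (ZMod p) V
  let bW := Algebra.TensorProduct.basis k bV
  have hbW : ∀ i, bW i = (1 : k) ⊗ₜ bV i := fun i => Algebra.TensorProduct.basis_apply bV i
  have hx1 : x = ∑ i, bW.repr x i • bW i := (bW.sum_repr x).symm
  have hx2 : frobT p k V x = ∑ i, (bW.repr x i) ^ p • bW i := by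
    conv_lhs => rw [hx1]
    rw [map_sum]
    refine Finset.sum_congr rfl fun i _ => ?_
    rw [frobT_smul, hbW, frobT_tmul, one_pow]
  have hc : ∀ i, (bW.repr x i) ^ p = bW.repr x i := by
    intro i
    have h3 := congrArg (fun y => bW.repr y i) (hx2.symm.trans hx)
    simpa [Finsupp.single_apply] using h3
  have hc' : ∀ i, ∃ c : ZMod p, algebraMap (ZMod p) k c = bW.repr x i := by
    intro i
    have h4 := (Subfield.mem_bot_iff_pow_eq_self k p).2 (hc i)
    rw [← ZMod.fieldRange_castHom_eq_bot p] at h4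
    obtain ⟨c, hc5⟩ := h4
    refine ⟨c, ?_⟩
    rw [← hc5]
    exact congrFun (congrArg DFunLike.coe (Subsingleton.elim (algebraMap (ZMod p) k) (ZMod.castHom (m := p) dvd_rfl k))) c
  choose c hcc using hc'
  refine ⟨∑ i, c i • bV i, ?_⟩
  rw [TensorProduct.tmul_sum]
  conv_lhs => rw [hx1]
  refine Finset.sum_congr rfl fun i _ => ?_
  rw [hbW, ← hcc, algebraMap_smul, TensorProduct.tmul_smul]

theorem bcForm_sep [Module.Finite (ZMod p) V] (B : LinearMap.BilinForm (ZMod p) V)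
    (hnd : B.Nondegenerate) (hsymm : B.IsSymm) (x : k ⊗[ZMod p] V)
    (hx : ∀ y, LinearMap.BilinForm.baseChange k B x y = 0) : x = 0 := by
  classical
  let bV := Module.finBasis (ZMod p) V
  let bW := Algebra.TensorProduct.basis k bV
  have hbW : ∀ i, bW i = (1 : k) ⊗ₜ bV i := fun i => Algebra.TensorProduct.basis_apply bV i
  have hx1 : x = ∑ i, bW.repr x i • bW i := (bW.sum_repr x).symm
  apply bW.ext_elem
  intro j
  have h := hx ((1 : k) ⊗ₜ B.dualBasis hnd bV j)
  rw [hx1] at h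
  simp only [map_sum, LinearMap.sum_apply, map_smul, LinearMap.smul_apply, hbW,
    LinearMap.BilinForm.baseChange_tmul, LinearMap.BilinForm.apply_dualBasis_right hnd hsymm] at h
  simpa using h

variable (B : LinearMap.BilinForm (ZMod p) V) (s : ℕ) (e : k ⊗[ZMod p] V)

theorem gram_le (i j : ℕ) (hij : i ≤ j) :
    LinearMap.BilinForm.baseChange k B ((frobT p k V)^[i] e) ((frobT p k V)^[j] e)
      = (LinearMap.BilinForm.baseChange k B e ((frobT p k V)^[j - i] e)) ^ p ^ i := by
  rw [← bcForm_frobT_iter, ← Function.iterate_add_apply, Nat.add_sub_cancel' hij]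

theorem bc_symm (hsymm : B.IsSymm) (x y : k ⊗[ZMod p] V) :
    LinearMap.BilinForm.baseChange k B x y = LinearMap.BilinForm.baseChange k B y x := by
  induction x using TensorProduct.induction_on with
  | zero => simp
  | add x x' hx hx' => simp only [map_add, LinearMap.add_apply, hx, hx']
  | tmul a v =>
    induction y using TensorProduct.induction_on with
    | zero => simp
    | add x x' hx hx' => simp only [map_add, LinearMap.add_apply, hx, hx']
    | tmul b w =>
      rw [LinearMap.BilinForm.baseChange_tmul, LinearMap.BilinForm.baseChange_tmul,
        mul_comm a b, hsymm.eq v w]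

theorem gram_zero (hsymm : B.IsSymm)
    (H0 : ∀ n < s, LinearMap.BilinForm.baseChange k B e ((frobT p k V)^[n] e) = 0)
    (i j : ℕ) (h1 : i < j + s) (h2 : j < i + s) :
    LinearMap.BilinForm.baseChange k B ((frobT p k V)^[i] e) ((frobT p k V)^[j] e) = 0 := by
  have hp : ∀ n, p ^ n ≠ 0 := fun n => pow_ne_zero _ (Fact.out : p.Prime).ne_zero
  rcases le_total i j with h | h
  · rw [gram_le B e i j h, H0 _ (by omega), zero_pow (hp _)]
  · rw [bc_symm B hsymm, gram_le B e j i h, H0 _ (by omega), zero_pow (hp _)]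

theorem gram_one
    (H1 : LinearMap.BilinForm.baseChange k B e ((frobT p k V)^[s] e) = 1) (i : ℕ) :
    LinearMap.BilinForm.baseChange k B ((frobT p k V)^[i] e) ((frobT p k V)^[i + s] e) = 1 := by
  rw [gram_le B e i _ (by omega), Nat.add_sub_cancel_left, H1, one_pow]

theorem indep_e (hsymm : B.IsSymm)
    (H0 : ∀ n < s, LinearMap.BilinForm.baseChange k B e ((frobT p k V)^[n] e) = 0)
    (H1 : LinearMap.BilinForm.baseChange k B e ((frobT p k V)^[s] e) = 1) (n : ℕ)
    (hn : n ≤ 2 * s) :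
    LinearIndependent k (fun i : Fin n => (frobT p k V)^[(i : ℕ)] e) := by
  apply indep_of_frobT_iter s
  simp only [← Function.iterate_add_apply]
  induction n with
  | zero => exact linearIndependent_empty_type
  | succ n ih =>
    rw [linearIndependent_finSucc']
    refine ⟨ih (by omega), ?_⟩
    intro hmem
    have hle : Submodule.span k (Set.range (Fin.init
        (fun i : Fin (n + 1) => (frobT p k V)^[s + (i : ℕ)] e))) ≤
        LinearMap.ker (LinearMap.BilinForm.baseChange k B ((frobT p k V)^[n] e)) := by
      rw [Submodule.span_le]
      rintro _ ⟨i, rfl⟩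
      have := i.2
      simp only [Fin.init, Fin.val_castSucc, SetLike.mem_coe, LinearMap.mem_ker]
      exact gram_zero B s e hsymm H0 _ _ (by omega) (by omega)
    have h := hle hmem
    simp only [Fin.val_last, LinearMap.mem_ker] at h
    rw [add_comm, gram_one B s e H1] at h
    exact one_ne_zero h

/-- Existence of the isometry of `k ⊗ V` with eigenvalue `l` on `e` commuting with Frobenius. -/
theorem exists_G (hodd : Odd p) (hs : 1 ≤ s) [Module.Finite (ZMod p) V]
    (hdim : Module.finrank (ZMod p) V = 2 * s)
    (hnd : B.Nondegenerate) (hsymm : B.IsSymm)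
    (H0 : ∀ n < s, LinearMap.BilinForm.baseChange k B e ((frobT p k V)^[n] e) = 0)
    (H1 : LinearMap.BilinForm.baseChange k B e ((frobT p k V)^[s] e) = 1)
    (l : k)
    (hl : ∀ n < 2 * s, LinearMap.BilinForm.baseChange k B e ((frobT p k V)^[n] e) = 0 ∨
      l ^ (p ^ n + 1) = 1) :
    ∃ G : (k ⊗[ZMod p] V) →ₗ[k] (k ⊗[ZMod p] V),
      (∀ x y, LinearMap.BilinForm.baseChange k B (G x) (G y)
        = LinearMap.BilinForm.baseChange k B x y) ∧
      (∀ x, G (frobT p k V x) = frobT p k V (G x)) ∧ G e = l • e := by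
  set b := LinearMap.BilinForm.baseChange k B with hb
  set E : ℕ → k ⊗[ZMod p] V := fun i => (frobT p k V)^[i] e with hE
  have hp0 : p ≠ 0 := (Fact.out : p.Prime).ne_zero
  have hls : l ^ (p ^ s + 1) = 1 :=
    (hl s (by omega)).resolve_left (by rw [H1]; exact one_ne_zero)
  have hl0 : l ≠ 0 := by rintro rfl; simp at hls
  have gz : ∀ i j, i < j + s → j < i + s → b (E i) (E j) = 0 := gram_zero B s e hsymm H0
  have g1 : ∀ i, b (E i) (E (i + s)) = 1 := gram_one B s e H1
  have bs : ∀ x y, b x y = b y x := bc_symm B hsymm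
  have hfr : Module.finrank k (k ⊗[ZMod p] V) = 2 * s := by
    rw [Module.finrank_baseChange, hdim]
  have hind := indep_e B s e hsymm H0 H1 (2 * s) le_rfl
  have : Nonempty (Fin (2 * s)) := ⟨⟨0, by omega⟩⟩
  let bE := basisOfLinearIndependentOfCardEqFinrank hind (by simp [hfr])
  have hbE : ∀ i, bE i = E i := fun i => by simp [bE, hE]
  let G : (k ⊗[ZMod p] V) →ₗ[k] (k ⊗[ZMod p] V) :=
    bE.constr k (fun i => l ^ p ^ (i : ℕ) • E i)
  have hG : ∀ i < 2 * s, G (E i) = l ^ p ^ i • E i := by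
    intro i hi
    have := bE.constr_basis k (fun i => l ^ p ^ (i : ℕ) • E i) ⟨i, hi⟩
    rwa [hbE] at this
  have hscale' : ∀ i j, i ≤ j → j < i + 2 * s →
      l ^ p ^ i * (l ^ p ^ j * b (E i) (E j)) = b (E i) (E j) := by
    intro i j hij hj
    have h := gram_le B e i j hij
    rcases hl (j - i) (by omega) with h0 | h0
    · have : b (E i) (E j) = 0 := by
        rw [hb, hE]; simp only []; rw [h, h0, zero_pow (pow_ne_zero _ hp0)]
      rw [this]; simp
    · have : l ^ p ^ i * l ^ p ^ j = 1 := by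
        have hj' : j = (j - i) + i := by omega
        rw [hj', pow_add p (j - i) i, pow_mul, ← mul_pow, ← pow_succ', h0, one_pow]
      rw [← mul_assoc, this, one_mul]
  have hscale : ∀ i j, i < j + 2 * s → j < i + 2 * s →
      l ^ p ^ i * (l ^ p ^ j * b (E i) (E j)) = b (E i) (E j) := by
    intro i j h1 h2
    rcases le_total i j with h | h
    · exact hscale' i j h h2
    · rw [bs, mul_left_comm]; exact hscale' j i h h1
  have hiso : ∀ x y, b (G x) (G y) = b x y := by
    have : b.comp G G = b := by
      apply LinearMap.BilinForm.ext_basis bE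
      intro i j
      have hi := i.2
      have hj := j.2
      rw [LinearMap.BilinForm.comp_apply, hbE, hbE, hG _ hi, hG _ hj]
      simp only [map_smul, LinearMap.smul_apply, smul_eq_mul]
      rw [← hscale i j (by omega) (by omega)]
      rw [hscale i j (by omega) (by omega), mul_left_comm]
      exact hscale i j (by omega) (by omega)
    intro x y
    exact congrFun (congrArg DFunLike.coe (congrFun (congrArg DFunLike.coe this) x)) y
  -- the crucial vector
  have hE2 : G (E (2 * s)) = l ^ p ^ (2 * s) • E (2 * s) := by
    set mu := l ^ p ^ (2 * s) with hmu
    have hmu0 : mu ≠ 0 := pow_ne_zero _ hl0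
    set f := G (E (2 * s)) - mu • E (2 * s) with hf
    have hperp : ∀ j, 1 ≤ j → j < 2 * s → b f (E j) = 0 := by
      intro j h1 h2
      have h3 := hiso (E (2 * s)) (E j)
      rw [hG j h2, map_smul, smul_eq_mul] at h3
      have h4 := hscale (2 * s) j (by omega) (by omega)
      rw [mul_left_comm] at h4
      have h5 := mul_left_cancel₀ (pow_ne_zero _ hl0) (h3.trans h4.symm)
      rw [hf, map_sub, LinearMap.sub_apply, h5, map_smul, LinearMap.smul_apply, smul_eq_mul,
        sub_self]
    set t := b f (E 0) with ht
    have hft : f = t • E s := by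
      rw [← sub_eq_zero]
      apply bcForm_sep B hnd hsymm
      intro y
      have : b (f - t • E s) = 0 := by
        apply bE.ext
        intro j
        rw [hbE, LinearMap.zero_apply, map_sub, LinearMap.sub_apply, map_smul,
          LinearMap.smul_apply, smul_eq_mul]
        rcases Nat.eq_zero_or_pos (j : ℕ) with h | h
        · have := g1 0
          rw [zero_add] at this
          rw [h, bs (E s), this, mul_one, ← ht, sub_self]
        · have := j.2
          rw [hperp _ h j.2, gz s j (by omega) (by omega), mul_zero, sub_zero]
      rw [← hb, this, LinearMap.zero_apply]
    have hGe : G (E (2 * s)) = mu • E (2 * s) + t • E s := by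
      rw [← hft, hf]; abel
    have h6 := hiso (E (2 * s)) (E (2 * s))
    have h7 := g1 s
    rw [← two_mul] at h7
    rw [hGe, gz (2 * s) (2 * s) (by omega) (by omega)] at h6
    simp only [map_add, map_smul, LinearMap.add_apply, LinearMap.smul_apply, smul_eq_mul,
      bs (E (2 * s)) (E s), h7, gz (2 * s) (2 * s) (by omega) (by omega),
      gz s s (by omega) (by omega)] at h6
    have h20 : (2 : k) ≠ 0 := by
      intro h2
      have h8 : p ∣ 2 := (CharP.cast_eq_zero_iff k p 2).1 (by exact_mod_cast h2)
      have h9 := (Nat.prime_dvd_prime_iff_eq Fact.out Nat.prime_two).1 h8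
      rw [h9] at hodd
      exact absurd hodd (by decide)
    have ht0 : t = 0 := by
      have : 2 * (mu * t) = 0 := by linear_combination h6
      exact (mul_eq_zero.1 ((mul_eq_zero.1 this).resolve_left h20)).resolve_left hmu0
    rw [hGe, ht0, zero_smul, add_zero]
  have hG' : ∀ i ≤ 2 * s, G (E i) = l ^ p ^ i • E i := by
    intro i hi
    rcases hi.lt_or_eq with h | h
    · exact hG i h
    · rw [h, hE2]
  refine ⟨G, hiso, ?_, ?_⟩
  · intro x
    have hx : x ∈ Submodule.span k (Set.range bE) := by rw [bE.span_eq]; trivial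
    induction hx using Submodule.span_induction with
    | zero => simp
    | add x y _ _ hx hy => simp only [map_add, hx, hy]
    | smul c x _ hx => rw [frobT_smul, map_smul, map_smul, frobT_smul, hx]
    | mem x hx =>
      obtain ⟨i, rfl⟩ := hx
      have hsucc : frobT p k V (E i) = E (i + 1) := by
        rw [hE]; simp only []; rw [Function.iterate_succ_apply']
      have := i.2
      rw [hbE, hsucc, hG' _ (by omega), hG' _ (by omega), frobT_smul, hsucc, ← pow_mul, pow_succ]
  · have := hG 0 (by omega)
    simpa [hE] using this

/-- Descent to `V` of a Frobenius-equivariant isometry. -/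
theorem exists_descent [Module.Finite (ZMod p) V]
    (hnd : B.Nondegenerate)
    (G : (k ⊗[ZMod p] V) →ₗ[k] (k ⊗[ZMod p] V))
    (hiso : ∀ x y, LinearMap.BilinForm.baseChange k B (G x) (G y)
        = LinearMap.BilinForm.baseChange k B x y)
    (hcomm : ∀ x, G (frobT p k V x) = frobT p k V (G x)) :
    ∃ g : V ≃ₗ[ZMod p] V, (∀ x y, B (g x) (g y) = B x y) ∧
      LinearMap.baseChange k (g : V →ₗ[ZMod p] V) = G := by
  have hex : ∀ v : V, ∃ w : V, G ((1 : k) ⊗ₜ v) = (1 : k) ⊗ₜ w := by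
    intro v
    apply frobT_fixed
    rw [← hcomm, frobT_tmul, one_pow]
  choose g hg using hex
  let gl : V →ₗ[ZMod p] V :=
    { toFun := g
      map_add' := fun x y => by
        apply one_tmul_injective (p := p) (k := k)
        simp only []
        rw [← hg, TensorProduct.tmul_add, map_add, hg, hg, TensorProduct.tmul_add]
      map_smul' := fun c x => by
        apply one_tmul_injective (p := p) (k := k)
        simp only [RingHom.id_apply]
        rw [← hg, TensorProduct.tmul_smul, ← algebraMap_smul k c, map_smul, hg, algebraMap_smul,
          TensorProduct.tmul_smul] }
  have hB : ∀ x y, B (gl x) (gl y) = B x y := by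
    intro x y
    have h := hiso ((1 : k) ⊗ₜ x) ((1 : k) ⊗ₜ y)
    rw [hg, hg, LinearMap.BilinForm.baseChange_tmul, LinearMap.BilinForm.baseChange_tmul,
      mul_one, Algebra.smul_def, Algebra.smul_def, mul_one, mul_one] at h
    exact (algebraMap (ZMod p) k).injective h
  have hinj : Function.Injective gl := by
    rw [injective_iff_map_eq_zero]
    intro x hx
    apply hnd.1
    intro y
    rw [← hB, hx]; simp
  refine ⟨LinearEquiv.ofInjectiveEndo gl hinj, ?_, ?_⟩
  · intro x y; exact hB x y
  · apply TensorProduct.AlgebraTensorModule.ext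
    intro a v
    have h1 : a ⊗ₜ[ZMod p] v = a • ((1 : k) ⊗ₜ[ZMod p] v) := by
      rw [TensorProduct.smul_tmul', smul_eq_mul, mul_one]
    rw [h1, map_smul, map_smul, hg, LinearMap.baseChange_tmul]
    rfl

end Helpers

section Final

theorem mem_map_iter {p : ℕ} [Fact p.Prime] {k : Type} [Field k] [CharP k p]
    [Algebra (ZMod p) k] [IsAlgClosed k]
    {V : Type} [AddCommGroup V] [Module (ZMod p) V] (K : Submodule k (k ⊗[ZMod p] V)) (n : ℕ)
    (x : k ⊗[ZMod p] V) :
    x ∈ (Submodule.map (frobT p k V))^[n] K ↔ ∃ y ∈ K, (frobT p k V)^[n] y = x := by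
  induction n generalizing x with
  | zero => simp
  | succ n ih =>
    rw [Function.iterate_succ_apply', Submodule.mem_map]
    constructor
    · rintro ⟨z, hz, rfl⟩
      obtain ⟨y, hy, rfl⟩ := (ih z).1 hz
      exact ⟨y, hy, Function.iterate_succ_apply' _ _ _⟩
    · rintro ⟨y, hy, rfl⟩
      exact ⟨_, (ih _).2 ⟨y, hy, rfl⟩, (Function.iterate_succ_apply' _ _ _).symm⟩

end Final

/-- `O_K(V)` is a cyclic group of order `p^m + 1`. -/
theorem statement8
    (p : ℕ) [Fact p.Prime] (hodd : Odd p)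
    (k : Type) [Field k] [CharP k p] [Algebra (ZMod p) k] [IsAlgClosed k]
    (V : Type) [AddCommGroup V] [Module (ZMod p) V]
    (σ₀ : ℕ) (hσ : 1 ≤ σ₀)
    (hdim : Module.finrank (ZMod p) V = 2 * σ₀)
    (B : LinearMap.BilinForm (ZMod p) V)
    (hsymm : B.IsSymm) (hnd : B.Nondegenerate)
    (hnn : ∀ W : Submodule (ZMod p) V,
      (∀ x ∈ W, ∀ y ∈ W, B x y = 0) → Module.finrank (ZMod p) W ≠ σ₀)
    (K : Submodule k (k ⊗[ZMod p] V))
    (hK : IsStrictlyCharacteristicSub p k V σ₀ B K)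
    (e : k ⊗[ZMod p] V)
    (hgen : Submodule.span k {e} = lK p k V σ₀ K)
    (hnorm : bcForm p k V B e ((⇑(frobT p k V))^[σ₀] e) = 1)
    (m : ℕ)
    (hm : m = sSup {m' : ℕ | 0 < m' ∧ m' ∣ σ₀ ∧ Odd (σ₀ / m') ∧
      ∀ i : ℕ, 1 ≤ i → i ≤ σ₀ - 1 → ¬ (2 * m' ∣ i) →
        bcForm p k V B e ((⇑(frobT p k V))^[σ₀ + i] e) = 0})
    :
    IsCyclic (OK p k V B K) ∧ Nat.card (OK p k V B K) = p ^ m + 1 := by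
  have hfin : Module.Finite (ZMod p) V := Module.finite_of_finrank_pos (by omega)
  obtain ⟨⟨hiso, hKdim, -⟩, -⟩ := hK
  have hp0 : p ≠ 0 := (Fact.out : p.Prime).ne_zero
  -- preimages of `e` in `K`
  have hlK : ∀ x, x ∈ lK p k V σ₀ K ↔ ∀ i < σ₀, ∃ y ∈ K, (frobT p k V)^[i] y = x := by
    intro x
    rw [lK, Submodule.mem_iInf]
    constructor
    · intro h i hi
      exact (mem_map_iter K i x).1 (h ⟨i, hi⟩)
    · intro h i
      exact (mem_map_iter K i x).2 (h i i.2)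
  have heK : ∀ i < σ₀, ∃ y ∈ K, (frobT p k V)^[i] y = e :=
    (hlK e).1 (hgen ▸ Submodule.mem_span_singleton_self e)
  have H0 : ∀ n < σ₀, LinearMap.BilinForm.baseChange k B e ((frobT p k V)^[n] e) = 0 := by
    intro n hn
    obtain ⟨y, hy, hye⟩ := heK (σ₀ - 1) (by omega)
    obtain ⟨z, hz, hze⟩ := heK (σ₀ - 1 - n) (by omega)
    have h1 : (frobT p k V)^[n] e = (frobT p k V)^[σ₀ - 1] z := by
      rw [← hze, ← Function.iterate_add_apply]
      congr 1
      congr 1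
      omega
    rw [h1]
    nth_rewrite 1 [← hye]
    rw [bcForm_frobT_iter, hiso y hy z hz, zero_pow (pow_ne_zero _ hp0)]
  have H1 : LinearMap.BilinForm.baseChange k B e ((frobT p k V)^[σ₀] e) = 1 := hnorm
  have he0 : e ≠ 0 := by
    rintro rfl
    rw [map_zero, LinearMap.zero_apply] at H1
    exact zero_ne_one H1
  have hnum := aux_numeric p hodd k σ₀ hσ
    (fun n => LinearMap.BilinForm.baseChange k B e ((frobT p k V)^[n] e)) H0 H1 m hm
  -- eigenvalue
  have heig : ∀ g : OK p k V B K, ∃ l : k,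
      LinearMap.baseChange k ((g : V ≃ₗ[ZMod p] V) : V →ₗ[ZMod p] V) e = l • e := by
    rintro ⟨g, hg1, hg2⟩
    have : LinearMap.baseChange k (g : V →ₗ[ZMod p] V) e ∈ Submodule.span k {e} := by
      rw [hgen, hlK]
      intro i hi
      obtain ⟨y, hy, hye⟩ := heK i hi
      refine ⟨LinearMap.baseChange k (g : V →ₗ[ZMod p] V) y, ?_, ?_⟩
      · rw [← hg2]; exact Submodule.mem_map_of_mem hy
      · rw [← hye, comm_iter _ (baseChange_frobT _)]
    obtain ⟨l, hl⟩ := Submodule.mem_span_singleton.1 this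
    exact ⟨l, hl.symm⟩
  choose ch hch using heig
  have huniq : ∀ a b : k, a • e = b • e → a = b := fun a b h => smul_left_injective k he0 h
  let χ : OK p k V B K →* k :=
    { toFun := ch
      map_one' := by
        apply huniq
        rw [← hch]
        change LinearMap.baseChange k (LinearMap.id : V →ₗ[ZMod p] V) e = _
        rw [LinearMap.baseChange_id, one_smul]; rfl
      map_mul' := by
        intro g h
        apply huniq
        rw [← hch]
        change LinearMap.baseChange k (((g : V ≃ₗ[ZMod p] V) : V →ₗ[ZMod p] V).comp
          ((h : V ≃ₗ[ZMod p] V) : V →ₗ[ZMod p] V)) e = _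
        rw [LinearMap.baseChange_comp, LinearMap.comp_apply, hch h, map_smul, hch g, smul_smul,
          mul_comm] }
  let X : OK p k V B K →* kˣ := χ.toHomUnits
  have hX : ∀ g, ((X g : kˣ) : k) = ch g := fun g => rfl
  have hfr : Module.finrank k (k ⊗[ZMod p] V) = 2 * σ₀ := by
    rw [Module.finrank_baseChange, hdim]
  have hind := indep_e B σ₀ e hsymm H0 H1 (2 * σ₀) le_rfl
  have hne : Nonempty (Fin (2 * σ₀)) := ⟨⟨0, by omega⟩⟩
  let bE := basisOfLinearIndependentOfCardEqFinrank hind (by simp [hfr])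
  have hbE : ∀ i, bE i = (frobT p k V)^[(i : ℕ)] e := fun i => by simp [bE]
  have hXinj : Function.Injective X := by
    rw [injective_iff_map_eq_one]
    intro g hg
    have h1 : ch g = 1 := by rw [← hX, hg]; rfl
    have h2 := hch g
    rw [h1, one_smul] at h2
    have h3 : LinearMap.baseChange k ((g : V ≃ₗ[ZMod p] V) : V →ₗ[ZMod p] V) = LinearMap.id := by
      apply bE.ext
      intro i
      rw [hbE, comm_iter _ (baseChange_frobT _), h2]; rfl
    apply Subtype.ext
    apply LinearEquiv.ext
    intro v
    apply one_tmul_injective (p := p) (k := k)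
    have h4 := LinearMap.congr_fun h3 ((1 : k) ⊗ₜ[ZMod p] v)
    rw [LinearMap.baseChange_tmul] at h4
    exact h4
  have hrange : X.range = rootsOfUnity (p ^ m + 1) k := by
    ext u
    rw [MonoidHom.mem_range, mem_rootsOfUnity, Units.ext_iff, Units.val_pow_eq_pow_val,
      Units.val_one, ← hnum]
    constructor
    · rintro ⟨g, rfl⟩ n hn
      rw [hX, or_iff_not_imp_left]
      intro hne0
      have h1 := bcForm_baseChange B ((g : V ≃ₗ[ZMod p] V) : V →ₗ[ZMod p] V) g.2.1
        e ((frobT p k V)^[n] e)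
      rw [comm_iter _ (baseChange_frobT _), hch, frobT_iter_smul, map_smul, map_smul,
        LinearMap.smul_apply, smul_smul, smul_eq_mul, ← pow_succ] at h1
      exact mul_right_cancel₀ hne0 (h1.trans (one_mul _).symm)
    · intro hu
      obtain ⟨G, hG1, hG2, hG3⟩ := exists_G B σ₀ e hodd hσ hdim hnd hsymm H0 H1 (u : k) hu
      obtain ⟨g, hg1, hg2⟩ := exists_descent B hnd G hG1 hG2
      have hGinj : Function.Injective G := by
        rw [injective_iff_map_eq_zero]
        intro x hx
        apply bcForm_sep B hnd hsymm
        intro y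
        rw [← hG1, hx, map_zero, LinearMap.zero_apply]
      -- `K` is spanned by the preimages of `e`
      choose! y hyK hye using heK
      have hyind : LinearIndependent k (fun i : Fin σ₀ => y i) := by
        apply indep_of_frobT_iter (σ₀ - 1)
        have h5 := indep_e B σ₀ e hsymm H0 H1 σ₀ (by omega)
        have h6 := h5.comp Fin.rev Fin.rev_injective
        convert h6 using 1
        funext i
        have hi := i.2
        simp only [Function.comp_apply, Fin.val_rev]
        have h7 : σ₀ - 1 = (σ₀ - (i + 1)) + i := by omega
        rw [h7, Function.iterate_add_apply, hye i hi]
      have hspan : Submodule.span k (Set.range (fun i : Fin σ₀ => y i)) = K := by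
        apply Submodule.eq_of_le_of_finrank_eq
        · rw [Submodule.span_le]
          rintro _ ⟨i, rfl⟩
          exact hyK i i.2
        · rw [finrank_span_eq_card hyind, hKdim, Fintype.card_fin]
      have hGK : Submodule.map G K = K := by
        apply Submodule.eq_of_le_of_finrank_eq
        · nth_rewrite 1 [← hspan]
          rw [Submodule.map_span, Submodule.span_le]
          rintro _ ⟨_, ⟨i, rfl⟩, rfl⟩
          obtain ⟨c, hc⟩ := IsAlgClosed.exists_pow_nat_eq (u : k)
            (n := p ^ (i : ℕ)) (Nat.pos_of_ne_zero (pow_ne_zero _ hp0))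
          have h8 : G (y i) = c • y i := by
            apply (frobT_injective (p := p) (k := k) (V := V)).iterate i
            rw [← comm_iter G hG2, frobT_iter_smul, hye i i.2, hG3, hc]
          simp only [h8]
          exact K.smul_mem c (hyK i i.2)
        · exact (Submodule.equivMapOfInjective G hGinj K).finrank_eq.symm
      refine ⟨⟨g, hg1, by rw [hg2, hGK]⟩, ?_⟩
      apply Units.ext
      rw [hX]
      apply huniq
      rw [← hch, ← hG3]
      exact LinearMap.congr_fun hg2 e
  have hN : NeZero ((p ^ m + 1 : ℕ) : k) := by
    refine ⟨fun h => ?_⟩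
    rw [CharP.cast_eq_zero_iff k p] at h
    rcases Nat.eq_zero_or_pos m with h0 | h0
    · rw [h0, pow_zero] at h
      have h9 := (Nat.prime_dvd_prime_iff_eq Fact.out Nat.prime_two).1 h
      rw [h9] at hodd
      exact absurd hodd (by decide)
    · have h10 := (Nat.dvd_add_right (dvd_pow_self p h0.ne')).1 h
      exact (Fact.out : p.Prime).one_lt.ne' (Nat.dvd_one.1 h10)
  let eqv : OK p k V B K ≃* rootsOfUnity (p ^ m + 1) k :=
    (MonoidHom.ofInjective hXinj).trans (MulEquiv.subgroupCongr hrange)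
  exact ⟨isCyclic_of_surjective eqv.symm eqv.symm.surjective,
    (Nat.card_congr eqv.toEquiv).trans (HasEnoughRootsOfUnity.natCard_rootsOfUnity k (p ^ m + 1))⟩
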